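/- Suppose an edge-coloring of K_n contains a rainbow copy of the complete bipartite graph K_{m-1, 2m+3} with parts X (of size m-1) and Y (of size 2m+3), where m = ⌊l/3⌋ and l ≡ r (mod 3), 0 ≤ r ≤ 2, l ≥ 6. If the coloring contains no properly colored path on l vertices, then the edges of K_n induced on Y ∪ Q use at most 1 + r colors, where Q = V(K_n) \ (X ∪ Y). -/

import Mathlib

/-- The edge-colored `K_n` contains a properly colored path on `l` vertices. -/
def HasPCPath (n l : ℕ) (c : Fin n → Fin n → ℕ) : Prop :=
  ∃ p : Fin l → Fin n, Function.Injective p ∧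
    ∀ i : ℕ, (h : i + 2 < l) →
      c (p ⟨i, by omega⟩) (p ⟨i + 1, by omega⟩) ≠
        c (p ⟨i + 1, by omega⟩) (p ⟨i + 2, h⟩)

variable {V : Type*}

/-- No properly colored path `a b d` in `W` ends in a vertex `d ∈ Y` through an edge of color
other than `f d`. -/
def NoGoodPath₃ (c : V → V → ℕ) (f : V → ℕ) (W Y : Finset V) : Prop :=
  ∀ v₁ ∈ W, ∀ v₂ ∈ W, ∀ v₃ ∈ Y, [v₁, v₂, v₃].Nodup →
    c v₁ v₂ ≠ c v₂ v₃ → c v₂ v₃ = f v₃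

/-- The analogue of `NoGoodPath₃` for paths on four vertices. -/
def NoGoodPath₄ (c : V → V → ℕ) (f : V → ℕ) (W Y : Finset V) : Prop :=
  ∀ v₁ ∈ W, ∀ v₂ ∈ W, ∀ v₃ ∈ W, ∀ v₄ ∈ Y, [v₁, v₂, v₃, v₄].Nodup →
    c v₁ v₂ ≠ c v₂ v₃ → c v₂ v₃ ≠ c v₃ v₄ → c v₃ v₄ = f v₄

/-- The analogue of `NoGoodPath₃` for paths on five vertices. -/
def NoGoodPath₅ (c : V → V → ℕ) (f : V → ℕ) (W Y : Finset V) : Prop :=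
  ∀ v₁ ∈ W, ∀ v₂ ∈ W, ∀ v₃ ∈ W, ∀ v₄ ∈ W, ∀ v₅ ∈ Y, [v₁, v₂, v₃, v₄, v₅].Nodup →
    c v₁ v₂ ≠ c v₂ v₃ → c v₂ v₃ ≠ c v₃ v₄ → c v₃ v₄ ≠ c v₄ v₅ → c v₄ v₅ = f v₅

/-- All edges from `z` to the rest of `W` have color `a`. -/
def IsMonoStar (c : V → V → ℕ) (W : Finset V) (z : V) (a : ℕ) : Prop :=
  z ∈ W ∧ ∀ u ∈ W, u ≠ z → c z u = a

/-- All edges inside `W` have one of the colors `a`, `b`, `d`. -/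
def ColorsIn (c : V → V → ℕ) (W : Finset V) (a b d : ℕ) : Prop :=
  ∀ u ∈ W, ∀ v ∈ W, u ≠ v → c u v = a ∨ c u v = b ∨ c u v = d

theorem exists_fresh [DecidableEq V] {f : V → ℕ} {Y : Finset V} (hf : Set.InjOn f Y)
    (S : Finset V) (T : Finset ℕ) (h : S.card + T.card < Y.card) : ∃ u ∈ Y, u ∉ S ∧ f u ∉ T := by
  by_contra! hc
  have h1 : (Y \ S).card ≤ T.card :=
    Finset.card_le_card_of_injOn f (fun u hu => by
      simp only [Finset.coe_sdiff, Set.mem_sdiff, Finset.mem_coe] at hu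
      exact hc u hu.1 hu.2) (hf.mono (by simp))
  have h2 := Finset.le_card_sdiff S Y
  omega

/-- All mono stars in `W` have a common color `a`. -/
theorem exists_monoStar_set (c : V → V → ℕ) (hsym : ∀ i j, c i j = c j i) (W : Finset V) :
    ∃ (Z : Finset V) (a : ℕ), (∀ z ∈ Z, IsMonoStar c W z a) ∧
      ∀ z b, IsMonoStar c W z b → z ∈ Z := by
  classical
  by_cases h : ∃ z a, IsMonoStar c W z a
  · obtain ⟨z, a, hz⟩ := h
    refine ⟨W.filter fun z => ∃ b, IsMonoStar c W z b, if ∃ w ∈ W, w ≠ z then a else 0, ?_, ?_⟩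
    · intro w hw
      simp only [Finset.mem_filter] at hw
      obtain ⟨hwW, b, hb⟩ := hw
      refine ⟨hwW, fun u hu hne => ?_⟩
      have hex : ∃ w ∈ W, w ≠ z := by
        by_cases hwz : w = z
        · exact ⟨u, hu, hwz ▸ hne⟩
        · exact ⟨w, hwW, hwz⟩
      rw [if_pos hex]
      by_cases hwz : w = z
      · subst hwz; exact hz.2 u hu hne
      · rw [hb.2 u hu hne, ← hb.2 z hz.1 (Ne.symm hwz), hsym, hz.2 w hwW hwz]
    · intro w b hb
      simp only [Finset.mem_filter]
      exact ⟨hb.1, b, hb⟩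
  · push Not at h
    exact ⟨∅, 0, by simp, fun z b hb => absurd hb (h z b)⟩

theorem exists_of_two_le_card_inter [DecidableEq V] {f : V → ℕ} {Y Z : Finset V}
    (hf : Set.InjOn f Y) (a : ℕ) (h : 2 ≤ (Y ∩ Z).card) :
    ∃ y ∈ Y, y ∈ Z ∧ f y ≠ a ∧ ∃ z ∈ Z, z ≠ y := by
  obtain ⟨p, hp, q, hq, hne⟩ := Finset.one_lt_card.1 h
  simp only [Finset.mem_inter] at hp hq
  by_cases hpa : f p = a
  · exact ⟨q, hq.1, hq.2, fun hqa => hne (hf hp.1 hq.1 (hpa.trans hqa.symm)), p, hp.2, hne⟩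
  · exact ⟨p, hp.1, hp.2, hpa, q, hq.2, hne.symm⟩

theorem NoGoodPath₃.colorsIn [DecidableEq V] {c : V → V → ℕ}
    (hsym : ∀ i j, c i j = c j i) {f : V → ℕ} {W Y : Finset V} (hYW : Y ⊆ W)
    (hf : Set.InjOn f Y) (hY : 3 ≤ Y.card)
    (h : NoGoodPath₃ c f W Y) : ∃ a, ColorsIn c W a a a := by
  obtain ⟨Z, a, hZ, hZ'⟩ := exists_monoStar_set c hsym W
  have key : ∀ y ∈ Y, ∀ y' ∈ Y, y ≠ y' → y ∈ Z ∨ y' ∈ Z := by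
    have aux : ∀ y ∈ Y, ∀ y' ∈ Y, y ≠ y' → c y y' ≠ f y' → y ∈ Z := by
      intro y hy y' hy' hne hc
      refine hZ' y (c y y') ⟨hYW hy, fun v hv hvy => ?_⟩
      by_cases hvy' : v = y'
      · rw [hvy']
      · by_contra hcv
        exact hc (h v hv y (hYW hy) y' hy' (by simp [*]) (by rwa [hsym v y]))
    intro y hy y' hy' hne
    by_cases hc : c y y' = f y'
    · right
      refine aux y' hy' y hy hne.symm fun hc' => hne (hf hy hy' ?_)
      rw [← hc, ← hc', hsym]
    · exact Or.inl (aux y hy y' hy' hne hc)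
  have hcard : (Y \ Z).card ≤ 1 := by
    rw [Finset.card_le_one]
    intro p hp q hq
    by_contra hne
    simp only [Finset.mem_sdiff] at hp hq
    rcases key p hp.1 q hq.1 hne with h | h
    exacts [hp.2 h, hq.2 h]
  have hsum := Finset.card_sdiff_add_card_inter Y Z
  obtain ⟨y, hyY, hyZ, hya, -⟩ := exists_of_two_le_card_inter hf a (Z := Z) (by omega)
  refine ⟨a, fun u hu v hv huv => ?_⟩
  have h1 := (hZ y hyZ).2
  by_cases huy : u = y
  · subst huy; simp [h1 v hv huv.symm]
  by_cases hvy : v = y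
  · subst hvy; simp [hsym u v, h1 u hu huv]
  have h2 := h1 v hv hvy
  have h3 := h u hu v hv y hyY (by simp; grind)
  grind

theorem NoGoodPath₄.color_eq {c : V → V → ℕ} (hsym : ∀ i j, c i j = c j i) {f : V → ℕ}
    {W Y : Finset V} (h : NoGoodPath₄ c f W Y) {v₁ v₂ v₃ : V} (h₁ : v₁ ∈ W) (h₂ : v₂ ∈ W)
    (h₃ : v₃ ∈ Y) (hnd : [v₁, v₂, v₃].Nodup) (h₁₂ : c v₁ v₂ ≠ c v₂ v₃) (hv₃ : c v₂ v₃ ≠ f v₃)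
    {u : V} (hu : u ∈ W) (hu' : u ≠ v₁ ∧ u ≠ v₂ ∧ u ≠ v₃) : c v₁ u = c v₁ v₂ := by
  by_contra hc
  exact hv₃ (h u hu v₁ h₁ v₂ h₂ v₃ h₃ (by simp at hnd ⊢; grind) (by rwa [hsym u]) h₁₂)

theorem NoGoodPath₄.exists_monoStar [DecidableEq V] {c : V → V → ℕ}
    (hsym : ∀ i j, c i j = c j i) {f : V → ℕ} {W Y : Finset V} (hYW : Y ⊆ W)
    (hf : Set.InjOn f Y) (hY : 6 ≤ Y.card)
    (h : NoGoodPath₄ c f W Y) {v₁ v₂ v₃ : V} (h₁ : v₁ ∈ W) (h₂ : v₂ ∈ W) (h₃ : v₃ ∈ Y)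
    (hnd : [v₁, v₂, v₃].Nodup) (h₁₂ : c v₁ v₂ ≠ c v₂ v₃) (hv₃ : c v₂ v₃ ≠ f v₃) :
    ∃ a, IsMonoStar c W v₁ a ∨ IsMonoStar c W v₃ a := by
  have hfirst := fun u (hu : u ∈ W) => h.color_eq hsym h₁ h₂ h₃ hnd h₁₂ hv₃ (u := u) hu
  simp at hnd
  by_cases h₁₃ : c v₁ v₃ = c v₁ v₂
  · refine ⟨c v₁ v₂, Or.inl ⟨h₁, fun u hu hne => ?_⟩⟩
    grind
  have hfresh : ∀ w, ∃ u ∈ Y, u ∉ ({v₁, v₂, v₃, w} : Finset V) ∧ f u ∉ ({c v₁ v₂} : Finset ℕ) :=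
    fun w => exists_fresh hf _ _ (by
      have := Finset.card_le_four (a := v₁) (b := v₂) (c := v₃) (d := w)
      simp only [Finset.card_singleton]; omega)
  refine ⟨c v₁ v₃, Or.inr ⟨hYW h₃, fun w hw hne => ?_⟩⟩
  obtain ⟨u, hu, hu', hfu⟩ := hfresh w
  simp only [Finset.mem_insert, Finset.mem_singleton, not_or] at hu' hfu
  have := hYW h₃
  have := hYW hu
  have h4 := hfirst u this (by simp [hu'])
  have h5 := h.color_eq hsym (hYW h₃) h₁ hu (by simp; grind) (by grind) (by grind) hw
  grind

theorem NoGoodPath₄.colorsIn [DecidableEq V] {c : V → V → ℕ}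
    (hsym : ∀ i j, c i j = c j i) {f : V → ℕ} {W Y : Finset V} (hYW : Y ⊆ W)
    (hf : Set.InjOn f Y) (hY : 6 ≤ Y.card)
    (h : NoGoodPath₄ c f W Y) : ∃ a b, ColorsIn c W a b b := by
  obtain ⟨Z, a, hZ, hZ'⟩ := exists_monoStar_set c hsym W
  have hsum := Finset.card_sdiff_add_card_inter Y Z
  by_cases hcard : 3 ≤ (Y \ Z).card
  · have h3 : NoGoodPath₃ c f (W \ Z) (Y \ Z) := by
      intro v₁ h₁ v₂ h₂ v₃ h₃ hnd h₁₂
      by_contra hv₃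
      simp only [Finset.mem_sdiff] at h₁ h₂ h₃
      obtain ⟨b, hb | hb⟩ := h.exists_monoStar hsym hYW hf hY h₁.1 h₂.1 h₃.1 hnd h₁₂ hv₃
      exacts [h₁.2 (hZ' _ _ hb), h₃.2 (hZ' _ _ hb)]
    obtain ⟨b, hb⟩ := h3.colorsIn hsym (Finset.sdiff_subset_sdiff hYW le_rfl)
      (hf.mono (by simp)) hcard
    refine ⟨a, b, fun u hu v hv huv => ?_⟩
    by_cases huZ : u ∈ Z
    · exact Or.inl ((hZ u huZ).2 v hv huv.symm)
    by_cases hvZ : v ∈ Z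
    · exact Or.inl (hsym u v ▸ (hZ v hvZ).2 u hu huv)
    have := hb u (by simp [*]) v (by simp [*]) huv
    tauto
  · obtain ⟨y, hyY, hyZ, hya, z, hzZ, hzy⟩ :=
      exists_of_two_le_card_inter hf a (Y := Y) (Z := Z) (by omega)
    refine ⟨a, a, fun u hu v hv huv => ?_⟩
    obtain ⟨hyW, hy⟩ := hZ y hyZ
    obtain ⟨hzW, hz⟩ := hZ z hzZ
    by_contra hc
    have := h z hzW u hu v hv y hyY (by simp; grind)
    grind

theorem NoGoodPath₅.color_eq {c : V → V → ℕ} (hsym : ∀ i j, c i j = c j i) {f : V → ℕ}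
    {W Y : Finset V} (h : NoGoodPath₅ c f W Y) {v₁ v₂ v₃ v₄ : V}
    (h₁ : v₁ ∈ W) (h₂ : v₂ ∈ W) (h₃ : v₃ ∈ W) (h₄ : v₄ ∈ Y) (hnd : [v₁, v₂, v₃, v₄].Nodup)
    (h₁₂ : c v₁ v₂ ≠ c v₂ v₃) (h₂₃ : c v₂ v₃ ≠ c v₃ v₄) (hv₄ : c v₃ v₄ ≠ f v₄)
    {u : V} (hu : u ∈ W) (hu' : u ≠ v₁ ∧ u ≠ v₂ ∧ u ≠ v₃ ∧ u ≠ v₄) : c v₁ u = c v₁ v₂ := by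
  by_contra hc
  exact hv₄ (h u hu v₁ h₁ v₂ h₂ v₃ h₃ v₄ h₄ (by simp at hnd ⊢; grind)
    (by rwa [hsym u]) h₁₂ h₂₃)

/-- Unless at most three colors appear, the end vertices of a good path on four vertices are
joined by an edge of the color of the first edge. -/
theorem NoGoodPath₅.end_color [DecidableEq V] {c : V → V → ℕ}
    (hsym : ∀ i j, c i j = c j i) {f : V → ℕ} {W Y : Finset V} (hYW : Y ⊆ W)
    (hf : Set.InjOn f Y) (hY : 7 ≤ Y.card)
    (h : NoGoodPath₅ c f W Y) (hcol : ¬ ∃ a b d, ColorsIn c W a b d) {v₁ v₂ v₃ v₄ : V}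
    (h₁ : v₁ ∈ W) (h₂ : v₂ ∈ W) (h₃ : v₃ ∈ W) (h₄ : v₄ ∈ Y) (hnd : [v₁, v₂, v₃, v₄].Nodup)
    (h₁₂ : c v₁ v₂ ≠ c v₂ v₃) (h₂₃ : c v₂ v₃ ≠ c v₃ v₄) (hv₄ : c v₃ v₄ ≠ f v₄) :
    c v₁ v₄ = c v₁ v₂ := by
  by_contra h₁₄
  have h₄W := hYW h₄
  have fresh : ∀ w x y d e,
      ∃ u ∈ Y, u ∈ W ∧ (u ≠ w ∧ u ≠ x ∧ u ≠ y ∧ u ≠ d ∧ u ≠ v₄) ∧ f u ≠ e := by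
    intro w x y d e
    obtain ⟨u, hu, hu1, hu2⟩ := exists_fresh hf {w, x, y, d, v₄} {e} (by
      have := Finset.card_le_five (a := w) (b := x) (c := y) (d := d) (e := v₄)
      simp only [Finset.card_singleton]; omega)
    exact ⟨u, hu, hYW hu, by simpa using hu1, by simpa using hu2⟩
  have e₁ := fun u (hu : u ∈ W) =>
    h.color_eq hsym h₁ h₂ h₃ h₄ hnd h₁₂ h₂₃ hv₄ (u := u) hu
  simp at hnd
  have h₁₄' : c v₁ v₄ = c v₃ v₄ := by
    by_contra hne
    obtain ⟨u, huY, huW, hu, hfu⟩ := fresh v₁ v₂ v₃ v₃ (c v₁ v₂)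
    have := e₁ u huW (by grind)
    have := h v₂ h₂ v₃ h₃ v₄ h₄W v₁ h₁ u huY (by simp; grind)
    grind
  have e₃ := fun u (hu : u ∈ W) => h.color_eq hsym h₃ h₂ h₁ h₄ (by simp; grind)
    (by grind) (by grind) (by grind) (u := u) hu
  have f₁ : ∀ u ∈ W, u ≠ v₁ ∧ u ≠ v₃ ∧ u ≠ v₄ → c v₁ u = c v₁ v₂ := by grind
  have f₃ : ∀ u ∈ W, u ≠ v₁ ∧ u ≠ v₃ ∧ u ≠ v₄ → c v₃ u = c v₂ v₃ := by grind
  clear e₁ e₃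
  have inner : ∀ u ∈ W, u ≠ v₁ ∧ u ≠ v₃ ∧ u ≠ v₄ → ∀ u' ∈ W,
      u' ≠ v₁ ∧ u' ≠ v₃ ∧ u' ≠ v₄ → u ≠ u' →
      c u u' = c v₁ v₂ ∨ c u u' = c v₂ v₃ := by
    intro u hu hu1 u' hu' hu1' hne
    have := h v₁ h₁ u hu u' hu' v₃ h₃ v₄ h₄ (by simp; grind)
    have := f₁ u hu hu1
    have := f₃ u' hu' hu1'
    grind
  have h₁₃ : c v₁ v₃ = c v₁ v₂ ∨ c v₁ v₃ = c v₂ v₃ ∨ c v₁ v₃ = c v₃ v₄ := by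
    obtain ⟨u, huY, huW, hu, -⟩ := fresh v₁ v₂ v₃ v₃ 0
    have := f₁ u huW (by grind)
    have := f₃ u huW (by grind)
    have := f₁ v₂ h₂ (by grind)
    have := inner v₂ h₂ (by grind) u huW (by grind) (by grind)
    have := h v₂ h₂ u huW v₁ h₁ v₃ h₃ v₄ h₄ (by simp; grind)
    have := h v₂ h₂ u huW v₃ h₃ v₁ h₁ v₄ h₄ (by simp; grind)
    grind
  have f₄ : ∀ u ∈ W, u ≠ v₁ ∧ u ≠ v₃ ∧ u ≠ v₄ →
      c v₄ u = c v₁ v₂ ∨ c v₄ u = c v₂ v₃ ∨ c v₄ u = c v₃ v₄ := by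
    intro u hu hu1
    by_contra! hc
    obtain ⟨u', hu'Y, hu'1, hu'2⟩ := exists_fresh hf {v₁, v₃, v₄, u} {c v₁ v₂, c v₂ v₃} (by
      have := Finset.card_le_four (a := v₁) (b := v₃) (c := v₄) (d := u)
      have := Finset.card_le_two (a := c v₁ v₂) (b := c v₂ v₃)
      omega)
    simp only [Finset.mem_insert, Finset.mem_singleton, not_or] at hu'1 hu'2
    obtain ⟨w, hwY, hwW, hw, -⟩ := fresh v₁ v₃ u u' 0
    have := f₁ w hwW (by grind)
    have := inner u hu hu1 u' (hYW hu'Y) (by grind) (by grind)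
    have := h w hwW v₁ h₁ v₄ h₄W u hu u' hu'Y (by simp; grind)
    grind
  refine hcol ⟨c v₁ v₂, c v₂ v₃, c v₃ v₄, ?_⟩
  have hcase : ∀ u ∈ W, u = v₁ ∨ u = v₃ ∨ u = v₄ ∨ (u ≠ v₁ ∧ u ≠ v₃ ∧ u ≠ v₄) := by grind
  intro u hu v hv huv
  rcases hcase u hu with rfl | rfl | rfl | hu' <;>
    rcases hcase v hv with rfl | rfl | rfl | hv' <;> grind

theorem NoGoodPath₅.color_eq_of_ne [DecidableEq V] {c : V → V → ℕ}
    (hsym : ∀ i j, c i j = c j i) {f : V → ℕ} {W Y : Finset V} (hYW : Y ⊆ W)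
    (hf : Set.InjOn f Y) (hY : 7 ≤ Y.card)
    (h : NoGoodPath₅ c f W Y) (hcol : ¬ ∃ a b d, ColorsIn c W a b d) {v₁ v₂ v₃ v₄ : V}
    (h₁ : v₁ ∈ W) (h₂ : v₂ ∈ W) (h₃ : v₃ ∈ W) (h₄ : v₄ ∈ Y) (hnd : [v₁, v₂, v₃, v₄].Nodup)
    (h₁₂ : c v₁ v₂ ≠ c v₂ v₃) (h₂₃ : c v₂ v₃ ≠ c v₃ v₄) (hv₄ : c v₃ v₄ ≠ f v₄)
    {u : V} (hu : u ∈ W) (hu' : u ≠ v₁ ∧ u ≠ v₃) : c v₁ u = c v₁ v₂ := by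
  by_cases hu₂ : u = v₂
  · rw [hu₂]
  by_cases hu₄ : u = v₄
  · rw [hu₄]; exact h.end_color hsym hYW hf hY hcol h₁ h₂ h₃ h₄ hnd h₁₂ h₂₃ hv₄
  · exact h.color_eq hsym h₁ h₂ h₃ h₄ hnd h₁₂ h₂₃ hv₄ hu ⟨hu'.1, hu₂, hu'.2, hu₄⟩

theorem NoGoodPath₅.exists_monoStar [DecidableEq V] {c : V → V → ℕ}
    (hsym : ∀ i j, c i j = c j i) {f : V → ℕ} {W Y : Finset V} (hYW : Y ⊆ W)
    (hf : Set.InjOn f Y) (hY : 7 ≤ Y.card)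
    (h : NoGoodPath₅ c f W Y) (hcol : ¬ ∃ a b d, ColorsIn c W a b d) {v₁ v₂ v₃ v₄ : V}
    (h₁ : v₁ ∈ W) (h₂ : v₂ ∈ W) (h₃ : v₃ ∈ W) (h₄ : v₄ ∈ Y) (hnd : [v₁, v₂, v₃, v₄].Nodup)
    (h₁₂ : c v₁ v₂ ≠ c v₂ v₃) (h₂₃ : c v₂ v₃ ≠ c v₃ v₄) (hv₄ : c v₃ v₄ ≠ f v₄) :
    ∃ a, IsMonoStar c W v₁ a ∨ IsMonoStar c W v₄ a := by
  have h₄W := hYW h₄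
  have e₁ := fun u (hu : u ∈ W) => h.color_eq_of_ne hsym hYW hf hY hcol h₁ h₂ h₃ h₄ hnd
    h₁₂ h₂₃ hv₄ (u := u) hu
  simp at hnd
  by_cases h₁₃ : c v₁ v₃ = c v₁ v₂
  · exact ⟨c v₁ v₂, Or.inl ⟨h₁, fun u hu hne => by grind⟩⟩
  have fresh : ∀ w e, ∃ u ∈ Y, u ∈ W ∧ (u ≠ v₁ ∧ u ≠ v₂ ∧ u ≠ v₃ ∧ u ≠ v₄ ∧ u ≠ w) ∧ f u ≠ e := by
    intro w e
    obtain ⟨u, hu, hu1, hu2⟩ := exists_fresh hf {v₁, v₂, v₃, v₄, w} {e} (by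
      have := Finset.card_le_five (a := v₁) (b := v₂) (c := v₃) (d := v₄) (e := w)
      simp only [Finset.card_singleton]; omega)
    exact ⟨u, hu, hYW hu, by simpa using hu1, by simpa using hu2⟩
  obtain ⟨u, huY, huW, hu, hfu⟩ := fresh v₁ (c v₁ v₂)
  have hu₁ := e₁ u huW (by grind)
  by_cases h₃₄ : c v₃ v₄ = c v₁ v₃
  · exfalso
    have e₂ := fun u (hu : u ∈ W) => h.color_eq_of_ne hsym hYW hf hY hcol h₂ h₃ h₁ huY
      (by simp; grind) (by grind) (by grind) (by grind) (u := u) hu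
    obtain ⟨w, hwY, hwW, hw, hfw⟩ := fresh u (c v₂ v₃)
    have hw₂ := e₂ w hwW (by grind)
    have hw₁ := e₁ w hwW (by grind)
    have hu₂ := e₂ u huW (by grind)
    have e₃ := fun u (hu : u ∈ W) => h.color_eq_of_ne hsym hYW hf hY hcol h₃ h₁ h₂ hwY
      (by simp; grind) (by grind) (by grind) (by grind) (u := u) hu
    have aux : ∀ u ∈ Y, ∀ w ∈ Y, u ∈ W → w ∈ W →
        u ≠ v₁ ∧ u ≠ v₂ ∧ u ≠ v₃ → w ≠ v₁ ∧ w ≠ v₂ ∧ w ≠ v₃ →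
        u ≠ w → c u w = f w := by
      intro u huY w hwY huW hwW hu hw huw
      have := e₁ u huW (by grind)
      have := e₂ u huW (by grind)
      have := h v₃ h₃ v₁ h₁ v₂ h₂ u huW w hwY (by simp; grind)
      have := h v₂ h₂ v₃ h₃ v₁ h₁ u huW w hwY (by simp; grind)
      grind
    have a₁ := aux u huY w hwY huW hwW (by grind) (by grind) (by grind)
    have a₂ := aux w hwY u huY hwW huW (by grind) (by grind) (by grind)
    have : u = w := hf huY hwY (by rw [← a₁, ← a₂, hsym])
    grind
  have e₄ := fun u (hu : u ∈ W) => h.color_eq_of_ne hsym hYW hf hY hcol h₄W h₃ h₁ huY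
      (by simp; grind) (by grind) (by grind) (by grind) (u := u) hu
  have h₁₄ := e₁ v₄ h₄W (by grind)
  have h₂₃' : c v₂ v₃ = c v₁ v₃ := by
    by_contra hne
    have e₂ := fun u (hu : u ∈ W) => h.color_eq_of_ne hsym hYW hf hY hcol h₂ h₃ h₁ huY
      (by simp; grind) (by grind) (by grind) (by grind) (u := u) hu
    have := e₂ v₄ h₄W (by grind)
    have := e₄ v₂ h₂ (by grind)
    grind
  by_cases hα : c v₃ v₄ = c v₁ v₂
  · exact ⟨c v₁ v₂, Or.inr ⟨h₄W, fun u hu hne => by grind⟩⟩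
  exfalso
  obtain ⟨w, hwY, hwW, hw, hfw⟩ := fresh u (c v₃ v₄)
  have hw₄ := e₄ w hwW (by grind)
  have e₃ := fun u (hu : u ∈ W) => h.color_eq_of_ne hsym hYW hf hY hcol h₃ h₁ h₄W hwY
      (by simp; grind) (by grind) (by grind) (by grind) (u := u) hu
  have inner : ∀ u ∈ W, u ≠ v₁ ∧ u ≠ v₃ ∧ u ≠ v₄ → ∀ u' ∈ W,
      u' ≠ v₁ ∧ u' ≠ v₃ ∧ u' ≠ v₄ → u ≠ u' →
      c u u' = c v₁ v₂ := by
    intro u hu hu1 u' hu' hu1' hne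
    have := e₁ u' hu' (by grind)
    have := h u hu u' hu' v₁ h₁ v₃ h₃ v₄ h₄ (by simp; grind)
    grind
  refine hcol ⟨c v₁ v₂, c v₁ v₃, c v₃ v₄, ?_⟩
  have hcase : ∀ u ∈ W, u = v₁ ∨ u = v₃ ∨ u = v₄ ∨ (u ≠ v₁ ∧ u ≠ v₃ ∧ u ≠ v₄) := by grind
  clear fresh h
  intro u hu v hv huv
  rcases hcase u hu with rfl | rfl | rfl | hu' <;>
    rcases hcase v hv with rfl | rfl | rfl | hv' <;> grind

theorem NoGoodPath₅.colorsIn [DecidableEq V] {c : V → V → ℕ}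
    (hsym : ∀ i j, c i j = c j i) {f : V → ℕ} {W Y : Finset V} (hYW : Y ⊆ W)
    (hf : Set.InjOn f Y) (hY : 7 ≤ Y.card)
    (h : NoGoodPath₅ c f W Y) : ∃ a b d, ColorsIn c W a b d := by
  by_contra hcol
  obtain ⟨Z, a, hZ, hZ'⟩ := exists_monoStar_set c hsym W
  have hsum := Finset.card_sdiff_add_card_inter Y Z
  by_cases hcard : 6 ≤ (Y \ Z).card
  · have h4 : NoGoodPath₄ c f (W \ Z) (Y \ Z) := by
      intro v₁ h₁ v₂ h₂ v₃ h₃ v₄ h₄ hnd h₁₂ h₂₃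
      by_contra hv₄
      simp only [Finset.mem_sdiff] at h₁ h₂ h₃ h₄
      obtain ⟨b, hb | hb⟩ := h.exists_monoStar hsym hYW hf hY hcol h₁.1 h₂.1 h₃.1 h₄.1 hnd
        h₁₂ h₂₃ hv₄
      exacts [h₁.2 (hZ' _ _ hb), h₄.2 (hZ' _ _ hb)]
    obtain ⟨b, d, hb⟩ := h4.colorsIn hsym (Finset.sdiff_subset_sdiff hYW le_rfl)
      (hf.mono (by simp)) hcard
    refine hcol ⟨a, b, d, fun u hu v hv huv => ?_⟩
    by_cases huZ : u ∈ Z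
    · exact Or.inl ((hZ u huZ).2 v hv huv.symm)
    by_cases hvZ : v ∈ Z
    · exact Or.inl (hsym u v ▸ (hZ v hvZ).2 u hu huv)
    have := hb u (by simp [*]) v (by simp [*]) huv
    tauto
  · obtain ⟨y, hyY, hyZ, hya, z, hzZ, hzy⟩ :=
      exists_of_two_le_card_inter hf a (Y := Y) (Z := Z) (by omega)
    obtain ⟨hyW, hy⟩ := hZ y hyZ
    obtain ⟨hzW, hz⟩ := hZ z hzZ
    clear hZ hZ' hsum hcard
    have adj : ∀ u ∈ W, ∀ v ∈ W, ∀ w ∈ W, [u, v, w].Nodup → c u v ≠ a → c v w ≠ a →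
        c u v = c v w := by
      intro u hu v hv w hw hnd huv hvw
      simp at hnd
      by_contra hne
      have := h z hzW u hu v hv w hw y hyY (by simp; grind)
      grind
    have disj : ∀ u ∈ W, ∀ v ∈ W, ∀ p ∈ W, ∀ q ∈ W, [u, v, p, q].Nodup → c u v ≠ a →
        c p q ≠ a → c u v = c p q := by
      intro u hu v hv p hp q hq hnd huv hpq
      simp at hnd
      by_cases hvp : c v p = a
      · by_contra hne
        have := h u hu v hv p hp q hq y hyY (by simp; grind)
        grind
      · have := adj u hu v hv p hp (by simp; grind) huv hvp
        have := adj v hv p hp q hq (by simp; grind) hvp hpq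
        grind
    by_cases hex : ∃ u ∈ W, ∃ v ∈ W, u ≠ v ∧ c u v ≠ a
    · obtain ⟨u, hu, v, hv, huv, hne⟩ := hex
      refine hcol ⟨a, c u v, c u v, fun p hp q hq hpq => ?_⟩
      by_cases hpqa : c p q = a
      · exact Or.inl hpqa
      refine Or.inr (Or.inl (Eq.symm ?_))
      have hvu : c v u ≠ a := hsym u v ▸ hne
      have hqp : c q p ≠ a := hsym p q ▸ hpqa
      by_cases h₁ : u = p
      · by_cases h₂ : v = q
        · rw [h₁, h₂]
        · have := adj v hv u hu q hq (by simp; grind) hvu (h₁ ▸ hpqa)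
          grind
      by_cases h₂ : u = q
      · by_cases h₃ : v = p
        · rw [h₂, h₃, hsym]
        · have := adj v hv u hu p hp (by simp; grind) hvu (h₂ ▸ hqp)
          grind
      by_cases h₃ : v = p
      · exact h₃ ▸ adj u hu v hv q hq (by simp; grind) hne (h₃ ▸ hpqa)
      by_cases h₄ : v = q
      · rw [hsym p q]
        exact h₄ ▸ adj u hu v hv p hp (by simp; grind) hne (h₄ ▸ hqp)
      exact disj u hu v hv p hp q hq (by simp; grind) hne hpqa
    · push Not at hex
      exact hcol ⟨a, a, a, fun u hu v hv huv => Or.inl (hex u hu v hv huv)⟩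

/-- Consecutive edges of the walk given by a list of vertices have distinct colors. -/
def ProperlyColored (c : V → V → ℕ) : List V → Prop
  | a :: b :: d :: t => c a b ≠ c b d ∧ ProperlyColored c (b :: d :: t)
  | _ => True

theorem ProperlyColored.getElem_ne {c : V → V → ℕ} {L : List V} (h : ProperlyColored c L) (i : ℕ)
    (hi : i + 2 < L.length) : c L[i] L[i + 1] ≠ c L[i + 1] L[i + 2] := by
  induction L generalizing i with
  | nil => simp at hi
  | cons a t ih =>
    match t, i with
    | [], _ => simp at hi
    | [_], _ => simp at hi
    | b :: d :: t, 0 => exact h.1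
    | b :: d :: t, i + 1 => exact ih h.2 i (by simpa using hi)

/-- A properly colored path that ends in `Y` and leaves towards `x ∈ X` by a new color extends
by three vertices for each vertex of `X`. -/
theorem exists_extension [DecidableEq V] {c : V → V → ℕ}
    (hsym : ∀ i j, c i j = c j i) {Y : Finset V} (k : ℕ)
    (X : Finset V) (hdisj : Disjoint X Y)
    (hrainbow : ∀ x ∈ X, ∀ y ∈ Y, ∀ x' ∈ X, ∀ y' ∈ Y, c x y = c x' y' → x = x' ∧ y = y')
    (hX : X.card = k) (w v : V) (t : List V) (hnd : (w :: v :: t).Nodup)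
    (hpc : ProperlyColored c (w :: v :: t)) (hLX : ∀ u ∈ w :: v :: t, u ∉ X)
    (hw : w ∈ Y) (hcard : 2 * k ≤ (Y.filter fun y => y ∉ w :: v :: t).card)
    (hx : X.Nonempty → ∃ x ∈ X, c x w ≠ c w v) :
    ∃ L : List V, L.Nodup ∧ ProperlyColored c L ∧ L.length = (w :: v :: t).length + 3 * k := by
  induction k generalizing X w v t with
  | zero => exact ⟨_, hnd, hpc, rfl⟩
  | succ k ih =>
    obtain ⟨x, hxX, hxw⟩ := hx (Finset.card_pos.1 (by omega))
    obtain ⟨y, hy, y', hy', hne⟩ := Finset.one_lt_card.1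
      (show 1 < (Y.filter fun y => y ∉ w :: v :: t).card by omega)
    have horient : ∃ y ∈ Y, ∃ y' ∈ Y, y ≠ y' ∧ y ∉ w :: v :: t ∧ y' ∉ w :: v :: t ∧
        c x y ≠ c y y' ∧ ((X.erase x).Nonempty → ∃ x' ∈ X.erase x, c x' y' ≠ c y' y) := by
      simp only [Finset.mem_filter] at hy hy'
      by_cases hX' : (X.erase x).Nonempty
      · obtain ⟨x', hx'⟩ := hX'
        have hx'X := Finset.mem_of_mem_erase hx'
        have hxx' := Finset.ne_of_mem_erase hx'
        by_cases hc : c x y ≠ c y y' ∧ c x' y' ≠ c y' y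
        · exact ⟨y, hy.1, y', hy'.1, hne, hy.2, hy'.2, hc.1, fun _ => ⟨x', hx', hc.2⟩⟩
        · have r₁ := hrainbow x hxX y hy.1 x hxX y' hy'.1
          have r₂ := hrainbow x hxX y hy.1 x' hx'X y hy.1
          have r₃ := hrainbow x' hx'X y' hy'.1 x hxX y' hy'.1
          have r₄ := hrainbow x' hx'X y' hy'.1 x' hx'X y hy.1
          have := hsym y y'
          refine ⟨y', hy'.1, y, hy.1, hne.symm, hy'.2, hy.2, ?_, fun _ => ⟨x', hx', ?_⟩⟩ <;>
            grind
      · by_cases hc : c x y ≠ c y y'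
        · exact ⟨y, hy.1, y', hy'.1, hne, hy.2, hy'.2, hc, fun h => absurd h hX'⟩
        · have r₁ := hrainbow x hxX y hy.1 x hxX y' hy'.1
          have := hsym y y'
          exact ⟨y', hy'.1, y, hy.1, hne.symm, hy'.2, hy.2, by grind, fun h => absurd h hX'⟩
    clear hy hy' hne y y'
    obtain ⟨y, hy, y', hy', hne, hyL, hy'L, hxy, hx'⟩ := horient
    have hxY : ∀ u ∈ Y, u ≠ x := fun u hu hux => Finset.disjoint_left.1 hdisj hxX (hux ▸ hu)
    have hxL : x ∉ w :: v :: t := fun hxL => hLX x hxL hxX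
    have hXY : ∀ u ∈ Y, u ∉ X := fun u hu hux => Finset.disjoint_left.1 hdisj hux hu
    have hwy : w ≠ y := by rintro rfl; simp at hyL
    obtain ⟨L, hL, hLpc, hlen⟩ := ih (X.erase x)
      (hdisj.mono_left (Finset.erase_subset _ _))
      (fun x₁ h₁ y₁ h₂ x₂ h₃ y₂ h₄ => hrainbow x₁ (Finset.mem_of_mem_erase h₁) y₁ h₂ x₂
        (Finset.mem_of_mem_erase h₃) y₂ h₄)
      (by rw [Finset.card_erase_of_mem hxX]; omega) y' y (x :: w :: v :: t)
      (by
        have := hxY y hy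
        have := hxY y' hy'
        simp only [List.nodup_cons (a := y'), List.nodup_cons (a := y), List.nodup_cons (a := x)]
        refine ⟨?_, ?_, hxL, hnd⟩
        · simp only [List.mem_cons (a := y')] at hy'L ⊢; tauto
        · simp only [List.mem_cons (a := y)] at hyL ⊢; tauto)
      (by
        refine ⟨?_, ?_, ?_, hpc⟩
        · rw [hsym y' y, hsym y x]; exact hxy.symm
        · intro hc
          have := hrainbow x hxX y hy x hxX w hw (by rw [hsym x y]; exact hc)
          exact hwy this.2.symm
        · exact hxw)
      (by
        intro u hu
        simp only [List.mem_cons (b := y'), List.mem_cons (b := y), List.mem_cons (b := x)] at hu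
        rcases hu with rfl | rfl | rfl | hu
        · exact fun hc => hXY u hy' (Finset.mem_of_mem_erase hc)
        · exact fun hc => hXY u hy (Finset.mem_of_mem_erase hc)
        · exact Finset.notMem_erase u X
        · exact fun hc => hLX u hu (Finset.mem_of_mem_erase hc))
      hy'
      (by
        have hsub : ((Y.filter fun u => u ∉ w :: v :: t).erase y).erase y' ⊆
            Y.filter fun u => u ∉ y' :: y :: x :: w :: v :: t := by
          intro u hu
          simp only [Finset.mem_erase, Finset.mem_filter] at hu
          obtain ⟨h₁, h₂, h₃, h₄⟩ := hu
          have := hxY u h₃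
          rw [Finset.mem_filter]
          refine ⟨h₃, ?_⟩
          simp only [List.mem_cons (b := y'), List.mem_cons (b := y), List.mem_cons (b := x)]
          tauto
        have h₁ := Finset.card_le_card hsub
        have h₂ := Finset.pred_card_le_card_erase (s := Y.filter fun u => u ∉ w :: v :: t) (a := y)
        have h₃ := Finset.pred_card_le_card_erase
          (s := (Y.filter fun u => u ∉ w :: v :: t).erase y) (a := y')
        omega)
      hx'
    exact ⟨L, hL, hLpc, by simp only [List.length_cons] at hlen ⊢; omega⟩

theorem ProperlyColored.hasPCPath {n l : ℕ} {c : Fin n → Fin n → ℕ} {L : List (Fin n)}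
    (h : ProperlyColored c L) (hnd : L.Nodup) (hl : L.length = l) : HasPCPath n l c := by
  subst hl
  exact ⟨L.get, List.nodup_iff_injective_get.1 hnd, fun i hi => h.getElem_ne i hi⟩

theorem ColorsIn.card_le {n : ℕ} {c : Fin n → Fin n → ℕ} {X : Finset (Fin n)} {a b d : ℕ}
    (h : ColorsIn c (Finset.univ \ X) a b d) :
    ((((Finset.univ \ X) ×ˢ (Finset.univ \ X)).filter
        fun p : Fin n × Fin n => p.1 ≠ p.2).image fun p => c p.1 p.2).card
      ≤ ({a, b, d} : Finset ℕ).card := by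
  refine Finset.card_le_card fun e he => ?_
  simp only [Finset.mem_image, Finset.mem_filter, Finset.mem_product] at he
  obtain ⟨p, ⟨⟨h₁, h₂⟩, hne⟩, rfl⟩ := he
  simpa using h p.1 h₁ p.2 h₂ hne

/-- Suppose an edge-coloring of `K_n` contains a rainbow copy of `K_{m-1, 2m+3}`,
with parts `X` (of size `m-1`) and `Y` (of size `2m+3`), where `m = ⌊l/3⌋` and
`l ≥ 6`. If there is no properly colored path on `l` vertices, then the edges
induced on `Y ∪ Q = V(K_n) \ X` use at most `1 + r` colors, where `l ≡ r (mod 3)`. -/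
theorem colors_outside_le (n l : ℕ) (hl : 6 ≤ l)
    (c : Fin n → Fin n → ℕ) (hsym : ∀ i j, c i j = c j i)
    (X Y : Finset (Fin n)) (hdisj : Disjoint X Y)
    (hX : X.card = l / 3 - 1) (hY : Y.card = 2 * (l / 3) + 3)
    (hrainbow : ∀ x ∈ X, ∀ y ∈ Y, ∀ x' ∈ X, ∀ y' ∈ Y,
      c x y = c x' y' → x = x' ∧ y = y')
    (hno : ¬ HasPCPath n l c) :
    ((((Finset.univ \ X) ×ˢ (Finset.univ \ X)).filter
        fun p : Fin n × Fin n => p.1 ≠ p.2).image fun p => c p.1 p.2).card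
      ≤ 1 + l % 3 := by
  obtain ⟨x₀, hx₀⟩ : X.Nonempty := Finset.card_pos.1 (by omega)
  have hYW : Y ⊆ Finset.univ \ X := fun y hy => by
    simpa using fun hyX => Finset.disjoint_left.1 hdisj hyX hy
  have hf : Set.InjOn (c x₀) Y := fun y hy y' hy' he => (hrainbow x₀ hx₀ y hy x₀ hx₀ y' hy' he).2
  have extend : ∀ (w v : Fin n) (t : List (Fin n)), (w :: v :: t).Nodup →
      ProperlyColored c (w :: v :: t) → (∀ u ∈ w :: v :: t, u ∈ Finset.univ \ X) → w ∈ Y →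
      c x₀ w ≠ c w v → (w :: v :: t).length = 3 + l % 3 → False := by
    intro w v t hnd hpc hW hw hxw hlen
    have hcard : 2 * (l / 3 - 1) ≤ (Y.filter fun y => y ∉ w :: v :: t).card := by
      have h₁ := Finset.le_card_sdiff (w :: v :: t).toFinset Y
      have h₂ := (w :: v :: t).toFinset_card_le
      have h₃ : Y \ (w :: v :: t).toFinset = Y.filter fun y => y ∉ w :: v :: t := by
        ext; simp
      rw [h₃] at h₁
      omega
    obtain ⟨L, hL, hLpc, hLlen⟩ := exists_extension hsym _ X hdisj hrainbow hX w v t hnd hpc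
      (fun u hu => by simpa using hW u hu) hw hcard fun _ => ⟨x₀, hx₀, hxw⟩
    exact hno (hLpc.hasPCPath hL (by omega))
  have hr : l % 3 = 0 ∨ l % 3 = 1 ∨ l % 3 = 2 := by omega
  rcases hr with hr | hr | hr
  · have h : NoGoodPath₃ c (c x₀) (Finset.univ \ X) Y := by
      intro v₁ h₁ v₂ h₂ v₃ h₃ hnd h₁₂
      by_contra hv
      refine extend v₃ v₂ [v₁] (List.nodup_reverse.2 hnd) ?_ ?_ h₃ ?_ (by simp [hr])
      · simp only [ProperlyColored, and_true]; grind
      · simpa only [List.forall_mem_cons] using ⟨hYW h₃, h₂, h₁, by simp⟩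
      · exact fun he => hv ((hsym _ _).trans he.symm)
    obtain ⟨a, ha⟩ := h.colorsIn hsym hYW hf (by omega)
    exact ha.card_le.trans (by simp)
  · have h : NoGoodPath₄ c (c x₀) (Finset.univ \ X) Y := by
      intro v₁ h₁ v₂ h₂ v₃ h₃ v₄ h₄ hnd h₁₂ h₂₃
      by_contra hv
      refine extend v₄ v₃ [v₂, v₁] (List.nodup_reverse.2 hnd) ?_ ?_ h₄ ?_ (by simp [hr])
      · simp only [ProperlyColored, and_true]; grind
      · simpa only [List.forall_mem_cons] using ⟨hYW h₄, h₃, h₂, h₁, by simp⟩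
      · exact fun he => hv ((hsym _ _).trans he.symm)
    obtain ⟨a, b, hab⟩ := h.colorsIn hsym hYW hf (by omega)
    refine hab.card_le.trans ?_
    simpa [hr] using Finset.card_le_two (a := a) (b := b)
  · have h : NoGoodPath₅ c (c x₀) (Finset.univ \ X) Y := by
      intro v₁ h₁ v₂ h₂ v₃ h₃ v₄ h₄ v₅ h₅ hnd h₁₂ h₂₃ h₃₄
      by_contra hv
      refine extend v₅ v₄ [v₃, v₂, v₁] (List.nodup_reverse.2 hnd) ?_ ?_ h₅ ?_ (by simp [hr])
      · simp only [ProperlyColored, and_true]; grind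
      · simpa only [List.forall_mem_cons] using ⟨hYW h₅, h₄, h₃, h₂, h₁, by simp⟩
      · exact fun he => hv ((hsym _ _).trans he.symm)
    obtain ⟨a, b, d, habd⟩ := h.colorsIn hsym hYW hf (by omega)
    refine habd.card_le.trans ?_
    simpa [hr] using Finset.card_le_three (a := a) (b := b) (c := d)
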